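/- arXiv:1804.03081 — 2 statements merged into one kernel-verified Lean document; each statement's English description precedes it below -/
import Mathlib

section
/- Existence of a Wardrop equilibrium (corollary of Rath): if each cost function c_t is continuous and each utility u_θ is continuous (in particular if the standing differentiability/concavity assumptions hold), then the nonatomic routing game admits a Wardrop equilibrium, i.e. there exists a measurable map x* : [0,1] → ℝ^T with x*_θ ∈ X_θ for a.e. θ such that, with X* = ∫_Θ x*_θ dθ, for a.e. θ and all y ∈ X_θ: Σ_t x*_{θ,t}·c_t(X*_t) − u_θ(x*_θ) ≤ Σ_t y_t·c_t(X*_t) − u_θ(y). -/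
open scoped RealInnerProductSpace BigOperators
open Metric Set MeasureTheory

theorem wd_exists_bound (μ : Measure ℝ) (f : (ℕ → ℕ) → ℝ) (c : ENNReal) (S : Set (ℕ → ℕ)) (k : ℕ)
    (h : c < μ (f '' S)) : ∃ m : ℕ, c < μ (f '' (S ∩ {x | x k ≤ m})) := by
  have hU : f '' S = ⋃ m : ℕ, f '' (S ∩ {x | x k ≤ m}) := by
    rw [← image_iUnion, ← inter_iUnion]
    congr 1
    ext x
    simp only [mem_inter_iff, mem_iUnion, mem_ofPred_eq]
    exact ⟨fun hx => ⟨hx, x k, le_rfl⟩, fun hx => hx.1⟩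
  have hmono : Monotone (fun m : ℕ => f '' (S ∩ {x | x k ≤ m})) := by
    intro a b hab
    apply image_mono
    rintro x ⟨h1, h2⟩
    exact ⟨h1, le_trans h2 hab⟩
  rw [hU, hmono.measure_iUnion] at h
  exact lt_iSup_iff.1 h

theorem wd_compact_inner (μ : Measure ℝ) [IsFiniteMeasure μ] (f : (ℕ → ℕ) → ℝ) (hf : Continuous f)
    (c : ENNReal) (h : c < μ (range f)) : ∃ K, IsCompact K ∧ K ⊆ range f ∧ c ≤ μ K := by
  classical
  let m : Set (ℕ → ℕ) → ℕ → ℕ := fun S k =>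
    if h : c < μ (f '' S) then (wd_exists_bound μ f c S k h).choose else 0
  let S : ℕ → Set (ℕ → ℕ) := fun k =>
    Nat.rec univ (fun k S => S ∩ {x | x k ≤ m S k}) k
  have hS0 : S 0 = univ := rfl
  have hSs : ∀ k, S (k+1) = S k ∩ {x | x k ≤ m (S k) k} := fun k => rfl
  let n : ℕ → ℕ := fun k => m (S k) k
  have hSc : ∀ k, c < μ (f '' (S k)) := by
    intro k
    induction k with
    | zero => rw [hS0, image_univ]; exact h
    | succ k ih =>
      rw [hSs]
      have : m (S k) k = (wd_exists_bound μ f c (S k) k ih).choose := by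
        simp only [m]; rw [dif_pos ih]
      rw [this]
      exact (wd_exists_bound μ f c (S k) k ih).choose_spec
  have hSn : ∀ k, ∀ x ∈ S k, ∀ i < k, x i ≤ n i := by
    intro k
    induction k with
    | zero => intro x _ i hi; omega
    | succ k ih =>
      intro x hx i hi
      rw [hSs] at hx
      rcases Nat.lt_succ_iff_lt_or_eq.1 hi with h1 | h1
      · exact ih x hx.1 i h1
      · subst h1; exact hx.2
  have hanti : Antitone S := antitone_nat_of_succ_le (fun k => by
    rw [hSs]; exact inter_subset_left)
  let K : Set (ℕ → ℕ) := Set.pi univ (fun i => Iic (n i))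
  have hK : IsCompact K := isCompact_univ_pi (fun i => (Set.finite_Iic (n i)).isCompact)
  refine ⟨f '' K, hK.image hf, image_subset_range _ _, ?_⟩
  have hsub : (⋂ k, closure (f '' (S k))) ⊆ f '' K := by
    intro y hy
    by_contra hyK
    have hd : Disjoint (f '' K) {y} := by simpa using hyK
    obtain ⟨U, V, hU, hV, hKU, hyV, hUV⟩ :=
      SeparatedNhds.of_isCompact_isCompact (hK.image hf) isCompact_singleton hd
    have hex : ∀ k, ∃ x ∈ S k, f x ∈ V := by
      intro k
      have h1 := mem_iInter.1 hy k
      obtain ⟨z, hz1, x, hx, rfl⟩ := mem_closure_iff.1 h1 V hV (hyV rfl)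
      exact ⟨x, hx, hz1⟩
    choose x hxS hxV using hex
    have hmin : ∀ k, (fun i => min (x k i) (n i)) ∈ K := by
      intro k i _
      show min (x k i) (n i) ≤ n i
      exact min_le_right _ _
    obtain ⟨z, hzK, φ, hφ, hlim⟩ := hK.tendsto_subseq hmin
    have hlim2 : Filter.Tendsto (fun j => x (φ j)) Filter.atTop (nhds z) := by
      rw [tendsto_pi_nhds] at hlim ⊢
      intro i
      refine (hlim i).congr' ?_
      filter_upwards [Filter.eventually_gt_atTop i] with j hj
      have : i < φ j := lt_of_lt_of_le hj (hφ.id_le j)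
      exact min_eq_left (hSn _ _ (hxS _) i this)
    have hfz : f z ∈ U := hKU (mem_image_of_mem f hzK)
    have h3 := ((hf.tendsto z).comp hlim2).eventually (hU.mem_nhds hfz)
    obtain ⟨j, hj⟩ := h3.exists
    exact Set.disjoint_left.1 hUV hj (hxV _)
  refine le_trans ?_ (measure_mono hsub)
  rw [Antitone.measure_iInter]
  · exact le_iInf (fun k => (hSc k).le.trans (measure_mono subset_closure))
  · intro a b hab
    exact closure_mono (image_mono (hanti hab))
  · exact fun k => isClosed_closure.measurableSet.nullMeasurableSet
  · exact ⟨0, measure_ne_top _ _⟩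

theorem wd_analytic (μ : Measure ℝ) [IsFiniteMeasure μ] (A : Set ℝ) (hA : AnalyticSet A) :
    NullMeasurableSet A μ := by
  rw [AnalyticSet] at hA
  rcases hA with rfl | ⟨f, hf, rfl⟩
  · exact nullMeasurableSet_empty
  by_cases h0 : μ (range f) = 0
  · exact NullMeasurableSet.of_null h0
  obtain ⟨c, -, hc, hlim⟩ := exists_seq_strictMono_tendsto' (pos_iff_ne_zero.2 h0)
  choose K hK hKs hKc using fun j => wd_compact_inner μ f hf (c j) (hc j).2
  have hm : MeasurableSet (⋃ j, K j) := MeasurableSet.iUnion (fun j => (hK j).measurableSet)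
  have hge : μ (range f) ≤ μ (⋃ j, K j) :=
    le_of_tendsto' hlim (fun j => (hKc j).trans (measure_mono (subset_iUnion K j)))
  have := ae_eq_of_subset_of_measure_ge (iUnion_subset hKs) hge hm.nullMeasurableSet
    (measure_ne_top _ _)
  exact hm.nullMeasurableSet.congr this

theorem wd_proj {E : Type*} [TopologicalSpace E] [PolishSpace E] [MeasurableSpace E] [BorelSpace E]
    (μ : Measure ℝ) [IsFiniteMeasure μ] (G : Set (ℝ × E)) (hG : MeasurableSet G) :
    NullMeasurableSet {θ | ∃ x, (θ, x) ∈ G} μ := by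
  have h : AnalyticSet (Prod.fst '' G) := hG.analyticSet.image_of_continuous continuous_fst
  convert wd_analytic μ _ h using 1
  ext θ
  simp

/-- A compact nonempty valued bounded correspondence with (a.e.) measurable graph. -/
structure WdCorr {T : ℕ} (μ : Measure ℝ) (M : ℝ) (A : ℝ → Set (EuclideanSpace ℝ (Fin T))) :
    Prop where
  cpt : ∀ θ, IsCompact (A θ)
  ne : ∀ θ, (A θ).Nonempty
  ball : ∀ θ, ∀ x ∈ A θ, ‖x‖ ≤ M
  graph : ∃ G : Set (ℝ × EuclideanSpace ℝ (Fin T)), MeasurableSet G ∧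
    ∀ᵐ θ ∂μ, ∀ x, (θ, x) ∈ G ↔ x ∈ A θ

/-- minimal value -/
noncomputable def wdMin {E : Type*} (A : ℝ → Set E) (f : ℝ → E → ℝ) (θ : ℝ) : ℝ :=
  sInf (f θ '' A θ)

/-- minimizers -/
def wdArg {E : Type*} (A : ℝ → Set E) (f : ℝ → E → ℝ) (θ : ℝ) : Set E :=
  {x | x ∈ A θ ∧ f θ x = wdMin A f θ}

section
variable {T : ℕ} {μ : Measure ℝ} {M : ℝ} {A : ℝ → Set (EuclideanSpace ℝ (Fin T))}
  {f : ℝ → EuclideanSpace ℝ (Fin T) → ℝ}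

theorem wdMin_le (hA : WdCorr μ M A) (hf : ∀ θ, Continuous (f θ)) {θ : ℝ}
    {x : EuclideanSpace ℝ (Fin T)} (hx : x ∈ A θ) : wdMin A f θ ≤ f θ x :=
  csInf_le ((hA.cpt θ).image (hf θ)).bddBelow (mem_image_of_mem _ hx)

theorem wdMin_mem (hA : WdCorr μ M A) (hf : ∀ θ, Continuous (f θ)) (θ : ℝ) :
    ∃ x ∈ A θ, f θ x = wdMin A f θ :=
  ((hA.cpt θ).image (hf θ)).sInf_mem ((hA.ne θ).image _)

theorem wdMin_aem [IsFiniteMeasure μ] (hA : WdCorr μ M A) (hf : ∀ θ, Continuous (f θ))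
    (hfm : Measurable (fun p : ℝ × EuclideanSpace ℝ (Fin T) => f p.1 p.2)) :
    AEMeasurable (wdMin A f) μ := by
  obtain ⟨G, hG, hGA⟩ := hA.graph
  apply NullMeasurable.aemeasurable
  apply measurable_of_Iio
  intro a
  have h1 : NullMeasurableSet {θ | ∃ x, (θ, x) ∈ G ∩ {p | f p.1 p.2 < a}} μ :=
    wd_proj μ _ (hG.inter (measurableSet_lt hfm measurable_const))
  refine NullMeasurableSet.congr h1 ?_
  filter_upwards [hGA] with θ hθ
  apply propext
  constructor
  · rintro ⟨x, hx1, hx2⟩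
    exact lt_of_le_of_lt (wdMin_le hA hf ((hθ x).1 hx1)) hx2
  · intro h
    obtain ⟨x, hx, hx2⟩ := wdMin_mem hA hf θ
    refine ⟨x, (hθ x).2 hx, ?_⟩
    change f θ x < a
    rw [hx2]; exact h

theorem WdCorr.arg [IsFiniteMeasure μ] (hA : WdCorr μ M A) (hf : ∀ θ, Continuous (f θ))
    (hfm : Measurable (fun p : ℝ × EuclideanSpace ℝ (Fin T) => f p.1 p.2)) :
    WdCorr μ M (wdArg A f) where
  cpt := fun θ => (hA.cpt θ).inter_right (isClosed_eq (hf θ) continuous_const)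
  ne := fun θ => by
    obtain ⟨x, hx, hx2⟩ := wdMin_mem hA hf θ
    exact ⟨x, hx, hx2⟩
  ball := fun θ x hx => hA.ball θ x hx.1
  graph := by
    obtain ⟨G, hG, hGA⟩ := hA.graph
    have hm := wdMin_aem hA hf hfm
    refine ⟨G ∩ {p | f p.1 p.2 = hm.mk _ p.1},
      hG.inter (measurableSet_eq_fun hfm (hm.measurable_mk.comp measurable_fst)), ?_⟩
    filter_upwards [hGA, hm.ae_eq_mk] with θ h1 h2 x
    have h3 : ((θ, x) ∈ G ∩ {p | f p.1 p.2 = hm.mk _ p.1}) ↔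
      ((θ, x) ∈ G ∧ f θ x = hm.mk _ θ) := Iff.rfl
    rw [h3, ← h2, h1 x]
    rfl

theorem wd_coord_meas (t : Fin T) :
    Measurable (fun p : ℝ × EuclideanSpace ℝ (Fin T) => p.2 t) := by fun_prop

theorem WdCorr.reduce [IsFiniteMeasure μ] (hA : WdCorr μ M A) (s : Finset (Fin T)) :
    ∃ B : ℝ → Set (EuclideanSpace ℝ (Fin T)), WdCorr μ M B ∧ (∀ θ, B θ ⊆ A θ) ∧
      ∀ t ∈ s, ∀ θ, ∀ x ∈ B θ, x t = wdMin B (fun _ x => x t) θ := by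
  classical
  induction s using Finset.induction_on with
  | empty => exact ⟨A, hA, fun _ => le_rfl, by simp⟩
  | insert t s _ ih =>
    obtain ⟨B, hB, hBA, hBs⟩ := ih
    have hc : ∀ t : Fin T, ∀ θ : ℝ, Continuous
      ((fun _ x => x t : ℝ → EuclideanSpace ℝ (Fin T) → ℝ) θ) := fun t θ => by fun_prop
    have hC : WdCorr μ M (wdArg B (fun _ x => x t)) :=
      hB.arg (hc t) (wd_coord_meas t)
    refine ⟨_, hC, fun θ x hx => hBA θ hx.1, ?_⟩
    intro t' ht' θ x hx
    obtain ⟨y, hy, hy2⟩ := wdMin_mem hC (hc t') θ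
    rw [← hy2]
    rcases Finset.mem_insert.1 ht' with rfl | h
    · exact hx.2.trans hy.2.symm
    · exact (hBs t' h θ x hx.1).trans (hBs t' h θ y hy.1).symm

theorem WdCorr.select [IsFiniteMeasure μ] (hA : WdCorr μ M A) :
    ∃ a : ℝ → EuclideanSpace ℝ (Fin T), Measurable a ∧ ∀ᵐ θ ∂μ, a θ ∈ A θ := by
  obtain ⟨B, hB, hBA, hBs⟩ := hA.reduce Finset.univ
  have hm : ∀ t, AEMeasurable (wdMin B (fun _ x => x t)) μ := fun t =>
    wdMin_aem hB (fun θ => by fun_prop) (wd_coord_meas t)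
  refine ⟨fun θ => WithLp.toLp 2 (fun t => (hm t).mk _ θ), ?_, ?_⟩
  · have : Measurable (fun θ => (fun t => (hm t).mk _ θ : Fin T → ℝ)) :=
      measurable_pi_lambda _ (fun t => (hm t).measurable_mk)
    exact (PiLp.continuous_toLp 2 _).measurable.comp this
  · have hall : ∀ᵐ θ ∂μ, ∀ t, wdMin B (fun _ x => x t) θ = (hm t).mk _ θ :=
      ae_all_iff.2 (fun t => (hm t).ae_eq_mk)
    filter_upwards [hall] with θ hθ
    obtain ⟨x, hx⟩ := hB.ne θ
    apply hBA θ
    convert hx using 1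
    ext t
    show (hm t).mk _ θ = x t
    rw [← hθ]
    exact (hBs t (Finset.mem_univ _) θ x hx).symm

theorem wd_danskin {E : Type*} [TopologicalSpace E] (K : Set E) (hK : IsCompact K)
    (hne : K.Nonempty) (f g : E → ℝ) (hf : Continuous f) (hg : Continuous g) :
    Filter.Tendsto (fun n : ℕ => ((n:ℝ) + 1) *
      (sInf ((fun x => f x + ((n:ℝ)+1)⁻¹ * g x) '' K) - sInf (f '' K))) Filter.atTop
      (nhds (sInf (g '' {x | x ∈ K ∧ f x = sInf (f '' K)}))) := by
  set K' := {x | x ∈ K ∧ f x = sInf (f '' K)} with hK'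
  have hle : ∀ {h : E → ℝ}, Continuous h → ∀ x ∈ K, sInf (h '' K) ≤ h x := fun hh x hx =>
    csInf_le (hK.image hh).bddBelow (mem_image_of_mem _ hx)
  have hex : ∀ {h : E → ℝ}, Continuous h → ∃ x ∈ K, h x = sInf (h '' K) := fun hh =>
    (hK.image hh).sInf_mem (hne.image _)
  have hK'c : IsCompact K' := hK.inter_right (isClosed_eq hf continuous_const)
  have hK'ne : K'.Nonempty := by
    obtain ⟨x, hx, h⟩ := hex hf
    exact ⟨x, hx, h⟩
  obtain ⟨x', hx', hx'm⟩ := (hK'c.image hg).sInf_mem (hK'ne.image _)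
  have hcont : ∀ n : ℕ, Continuous (fun x => f x + ((n:ℝ)+1)⁻¹ * g x) := fun n => by fun_prop
  have hpos : ∀ n : ℕ, (0:ℝ) < (n:ℝ) + 1 := fun n => by positivity
  have hupper : ∀ n : ℕ, ((n:ℝ) + 1) *
      (sInf ((fun x => f x + ((n:ℝ)+1)⁻¹ * g x) '' K) - sInf (f '' K)) ≤ sInf (g '' K') := by
    intro n
    have h1 := hle (hcont n) x' hx'.1
    rw [hx'.2, hx'm] at h1
    calc _ ≤ ((n:ℝ)+1) * (((n:ℝ)+1)⁻¹ * sInf (g '' K')) := by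
            apply mul_le_mul_of_nonneg_left _ (hpos n).le
            linarith
      _ = _ := by rw [mul_inv_cancel_left₀ (hpos n).ne']
  rw [Metric.tendsto_atTop]
  intro δ hδ
  set L := K ∩ {x | g x ≤ sInf (g '' K') - δ / 2} with hL
  have hLc : IsCompact L := hK.inter_right (isClosed_le hg continuous_const)
  -- gap
  have hgap : ∃ η > 0, ∀ x ∈ L, sInf (f '' K) + η ≤ f x := by
    rcases L.eq_empty_or_nonempty with h | h
    · exact ⟨1, one_pos, by simp [h]⟩
    · obtain ⟨z, hz, hzm⟩ := hLc.exists_isMinOn h hf.continuousOn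
      refine ⟨f z - sInf (f '' K), ?_, fun x hx => ?_⟩
      · have h1 := hle hf z hz.1
        rcases h1.lt_or_eq with h2 | h2
        · linarith
        · exfalso
          have h3 : sInf (g '' K') ≤ g z :=
            csInf_le (hK'c.image hg).bddBelow (mem_image_of_mem _ ⟨hz.1, h2.symm⟩)
          have h4 : g z ≤ sInf (g '' K') - δ / 2 := hz.2
          linarith
      · have := hzm hx
        have h5 : f z ≤ f x := this
        linarith
  obtain ⟨η, hη, hgapη⟩ := hgap
  obtain ⟨N, hN⟩ := exists_nat_gt ((sInf (g '' K') - sInf (g '' K)) / η)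
  refine ⟨N, fun n hn => ?_⟩
  rw [Real.dist_eq, abs_lt]
  have hup := hupper n
  refine ⟨?_, by linarith⟩
  obtain ⟨x, hx, hxm⟩ := hex (hcont n)
  rw [← hxm]
  have e : ((n:ℝ)+1) * (f x + ((n:ℝ)+1)⁻¹ * g x - sInf (f '' K)) =
      ((n:ℝ)+1) * (f x - sInf (f '' K)) + g x := by
    have := (hpos n).ne'
    field_simp
    ring
  rw [← hxm, e] at hup
  rw [e]
  by_cases hxL : x ∈ L
  · exfalso
    have h1 := hgapη x hxL
    have h2 := hle hg x hx
    have hnN : (N:ℝ) ≤ n := by exact_mod_cast hn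
    rw [div_lt_iff₀ hη] at hN
    have h3 : ((n:ℝ)+1) * η ≤ ((n:ℝ)+1) * (f x - sInf (f '' K)) :=
      mul_le_mul_of_nonneg_left (by linarith) (hpos n).le
    nlinarith
  · have h1 : sInf (g '' K') - δ / 2 < g x := by
      by_contra h
      exact hxL ⟨hx, not_lt.1 h⟩
    have h2 := hle hf x hx
    have h3 : 0 ≤ ((n:ℝ)+1) * (f x - sInf (f '' K)) :=
      mul_nonneg (hpos n).le (by linarith)
    linarith
end

section
variable {T : ℕ} {μ : Measure ℝ} {M : ℝ} {A : ℝ → Set (EuclideanSpace ℝ (Fin T))}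
  {f g : ℝ → EuclideanSpace ℝ (Fin T) → ℝ}

theorem wdMin_eq {E : Type*} {A : ℝ → Set E} {f : ℝ → E → ℝ} {θ : ℝ} {x : E} (hx : x ∈ A θ)
    (h : ∀ y ∈ A θ, f θ x ≤ f θ y) : wdMin A f θ = f θ x := by
  apply IsLeast.csInf_eq
  refine ⟨mem_image_of_mem _ hx, ?_⟩
  rintro _ ⟨y, hy, rfl⟩
  exact h y hy

theorem wdMin_le_add (hA : WdCorr μ M A) (hf : ∀ θ, Continuous (f θ)) (hg : ∀ θ, Continuous (g θ))
    {θ b : ℝ} (h : ∀ x ∈ A θ, f θ x ≤ g θ x + b) : wdMin A f θ ≤ wdMin A g θ + b := by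
  obtain ⟨x, hx, hx2⟩ := wdMin_mem hA hg θ
  rw [← hx2]
  exact (wdMin_le hA hf hx).trans (h x hx)

theorem wdMin_diff (hA : WdCorr μ M A) (hf : ∀ θ, Continuous (f θ)) (hg : ∀ θ, Continuous (g θ))
    {θ b : ℝ} (h : ∀ x ∈ A θ, |f θ x - g θ x| ≤ b) : |wdMin A f θ - wdMin A g θ| ≤ b := by
  rw [abs_le]
  have h1 := wdMin_le_add hA hf hg (θ := θ) (b := b)
    (fun x hx => by have := (abs_le.1 (h x hx)).2; linarith)
  have h2 := wdMin_le_add hA hg hf (θ := θ) (b := b)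
    (fun x hx => by have := (abs_le.1 (h x hx)).1; linarith)
  constructor <;> linarith

theorem wd_inner_bound (hA : WdCorr μ M A) (q : EuclideanSpace ℝ (Fin T)) {θ : ℝ}
    {x : EuclideanSpace ℝ (Fin T)} (hx : x ∈ A θ) : |inner ℝ q x| ≤ ‖q‖ * M :=
  (abs_real_inner_le_norm q x).trans (mul_le_mul_of_nonneg_left (hA.ball θ x hx) (norm_nonneg _))

/-- linear functional as a parametrised function -/
noncomputable def wdIp (q : EuclideanSpace ℝ (Fin T)) : ℝ → EuclideanSpace ℝ (Fin T) → ℝ :=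
  fun _ x => inner ℝ q x

theorem wdIp_cont (q : EuclideanSpace ℝ (Fin T)) : ∀ θ, Continuous (wdIp q θ) := fun θ => by
  unfold wdIp; fun_prop

theorem wdIp_meas (q : EuclideanSpace ℝ (Fin T)) :
    Measurable (fun p : ℝ × EuclideanSpace ℝ (Fin T) => wdIp q p.1 p.2) := by
  have : Continuous (fun p : ℝ × EuclideanSpace ℝ (Fin T) => wdIp q p.1 p.2) := by
    unfold wdIp; fun_prop
  exact this.measurable

theorem wdMin_ip_bound (hA : WdCorr μ M A) (q : EuclideanSpace ℝ (Fin T)) (θ : ℝ) :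
    |wdMin A (wdIp q) θ| ≤ ‖q‖ * M := by
  obtain ⟨x, hx, hx2⟩ := wdMin_mem hA (wdIp_cont q) θ
  rw [← hx2]
  exact wd_inner_bound hA q hx

theorem wdMin_diff_bound (hA : WdCorr μ M A) (hf : ∀ θ, Continuous (f θ))
    (q : EuclideanSpace ℝ (Fin T)) (θ : ℝ) :
    |wdMin A (fun θ x => f θ x + inner ℝ q x) θ - wdMin A f θ| ≤ ‖q‖ * M := by
  apply wdMin_diff hA (fun θ => by have := hf θ; fun_prop) hf
  intro x hx
  rw [add_sub_cancel_left]
  exact wd_inner_bound hA q hx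

theorem wd_meas_add (hfm : Measurable (fun p : ℝ × EuclideanSpace ℝ (Fin T) => f p.1 p.2))
    (q : EuclideanSpace ℝ (Fin T)) :
    Measurable (fun p : ℝ × EuclideanSpace ℝ (Fin T) => f p.1 p.2 + inner ℝ q p.2) :=
  hfm.add (wdIp_meas q)

theorem wdMin_diff_int [IsFiniteMeasure μ] (hA : WdCorr μ M A) (hf : ∀ θ, Continuous (f θ))
    (hfm : Measurable (fun p : ℝ × EuclideanSpace ℝ (Fin T) => f p.1 p.2))
    (q : EuclideanSpace ℝ (Fin T)) :
    Integrable (fun θ => wdMin A (fun θ x => f θ x + inner ℝ q x) θ - wdMin A f θ) μ := by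
  refine Integrable.of_bound (C := ‖q‖ * M) ?_ ?_
  · exact ((wdMin_aem hA (fun θ => by have := hf θ; fun_prop) (wd_meas_add hfm q)).sub
      (wdMin_aem hA hf hfm)).aestronglyMeasurable
  · exact Filter.Eventually.of_forall (fun θ => wdMin_diff_bound hA hf q θ)

theorem wdMin_ip_int [IsFiniteMeasure μ] (hA : WdCorr μ M A) (q : EuclideanSpace ℝ (Fin T)) :
    Integrable (wdMin A (wdIp q)) μ := by
  refine Integrable.of_bound (C := ‖q‖ * M) ?_ ?_
  · exact (wdMin_aem hA (wdIp_cont q) (wdIp_meas q)).aestronglyMeasurable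
  · exact Filter.Eventually.of_forall (fun θ => wdMin_ip_bound hA q θ)

theorem wd_int_danskin [IsFiniteMeasure μ] (hA : WdCorr μ M A) (hf : ∀ θ, Continuous (f θ))
    (hfm : Measurable (fun p : ℝ × EuclideanSpace ℝ (Fin T) => f p.1 p.2))
    (X : EuclideanSpace ℝ (Fin T))
    (h : ∀ q, ∫ θ, (wdMin A (fun θ x => f θ x + inner ℝ q x) θ - wdMin A f θ) ∂μ ≤ inner ℝ q X)
    (q : EuclideanSpace ℝ (Fin T)) :
    ∫ θ, wdMin (wdArg A f) (wdIp q) θ ∂μ ≤ inner ℝ q X := by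
  have hpos : ∀ n : ℕ, (0:ℝ) < (n:ℝ) + 1 := fun n => by positivity
  have hlim : Filter.Tendsto (fun n : ℕ => ∫ θ, ((n:ℝ)+1) *
      (wdMin A (fun θ x => f θ x + inner ℝ (((n:ℝ)+1)⁻¹ • q) x) θ - wdMin A f θ) ∂μ) Filter.atTop
      (nhds (∫ θ, wdMin (wdArg A f) (wdIp q) θ ∂μ)) := by
    apply tendsto_integral_of_dominated_convergence (fun _ => ‖q‖ * M)
    · intro n
      exact ((wdMin_diff_int hA hf hfm _).const_mul _).aestronglyMeasurable
    · exact integrable_const _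
    · intro n
      refine Filter.Eventually.of_forall (fun θ => ?_)
      rw [Real.norm_eq_abs, abs_mul, abs_of_pos (hpos n)]
      have h1 := wdMin_diff_bound hA hf (((n:ℝ)+1)⁻¹ • q) θ
      rw [norm_smul, Real.norm_eq_abs, abs_of_pos (inv_pos.2 (hpos n))] at h1
      calc _ ≤ ((n:ℝ)+1) * (((n:ℝ)+1)⁻¹ * ‖q‖ * M) := mul_le_mul_of_nonneg_left h1 (hpos n).le
        _ = _ := by rw [mul_assoc, mul_inv_cancel_left₀ (hpos n).ne']
    · refine Filter.Eventually.of_forall (fun θ => ?_)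
      have h1 := wd_danskin (A θ) (hA.cpt θ) (hA.ne θ) (f θ) (wdIp q θ) (hf θ) (wdIp_cont q θ)
      simp only [inner_smul_left, conj_trivial]
      exact h1
  refine le_of_tendsto' hlim (fun n => ?_)
  rw [integral_const_mul]
  have h1 := h (((n:ℝ)+1)⁻¹ • q)
  rw [inner_smul_left, conj_trivial] at h1
  calc _ ≤ ((n:ℝ)+1) * (((n:ℝ)+1)⁻¹ * inner ℝ q X) := mul_le_mul_of_nonneg_left h1 (hpos n).le
    _ = _ := by rw [mul_inv_cancel_left₀ (hpos n).ne']

theorem wd_sel_int [IsFiniteMeasure μ] (hA : WdCorr μ M A) {a : ℝ → EuclideanSpace ℝ (Fin T)}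
    (ha : Measurable a) (haA : ∀ᵐ θ ∂μ, a θ ∈ A θ) : Integrable a μ := by
  refine Integrable.of_bound (C := M) ha.aestronglyMeasurable ?_
  filter_upwards [haA] with θ h using hA.ball θ _ h

/-- freeze the selection before time `s` -/
def wdFreeze (A : ℝ → Set (EuclideanSpace ℝ (Fin T))) (a : ℝ → EuclideanSpace ℝ (Fin T)) (s : ℝ)
    (θ : ℝ) : Set (EuclideanSpace ℝ (Fin T)) :=
  {x | x ∈ A θ ∧ (θ < s → a θ ∈ A θ → x = a θ)}

theorem wdFreeze_of {a : ℝ → EuclideanSpace ℝ (Fin T)} {s θ : ℝ} (h : θ < s) (h2 : a θ ∈ A θ) :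
    wdFreeze A a s θ = {a θ} := by
  ext x
  constructor
  · intro hx; exact hx.2 h h2
  · intro hx
    have : x = a θ := hx
    subst this
    exact ⟨h2, fun _ _ => rfl⟩

theorem wdFreeze_of_not {a : ℝ → EuclideanSpace ℝ (Fin T)} {s θ : ℝ} (h : ¬ (θ < s ∧ a θ ∈ A θ)) :
    wdFreeze A a s θ = A θ := by
  ext x
  constructor
  · intro hx; exact hx.1
  · intro hx
    exact ⟨hx, fun h1 h2 => absurd ⟨h1, h2⟩ h⟩

theorem WdCorr.freeze (hA : WdCorr μ M A) {a : ℝ → EuclideanSpace ℝ (Fin T)}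
    (ha : Measurable a) (haA : ∀ᵐ θ ∂μ, a θ ∈ A θ) (s : ℝ) : WdCorr μ M (wdFreeze A a s) where
  cpt := fun θ => by
    by_cases h : θ < s ∧ a θ ∈ A θ
    · rw [wdFreeze_of h.1 h.2]; exact isCompact_singleton
    · rw [wdFreeze_of_not h]; exact hA.cpt θ
  ne := fun θ => by
    by_cases h : θ < s ∧ a θ ∈ A θ
    · rw [wdFreeze_of h.1 h.2]; exact singleton_nonempty _
    · rw [wdFreeze_of_not h]; exact hA.ne θ
  ball := fun θ x hx => hA.ball θ x hx.1
  graph := by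
    obtain ⟨G, hG, hGA⟩ := hA.graph
    refine ⟨G ∩ ({p | s ≤ p.1} ∪ {p | p.2 = a p.1}), hG.inter
      ((measurableSet_le measurable_const measurable_fst).union
        (measurableSet_eq_fun measurable_snd (ha.comp measurable_fst))), ?_⟩
    filter_upwards [hGA, haA] with θ h1 h2 x
    constructor
    · rintro ⟨h3, h4⟩
      refine ⟨(h1 x).1 h3, fun h5 _ => ?_⟩
      rcases h4 with h4 | h4
      · exact absurd h5 (not_lt.2 h4)
      · exact h4
    · rintro ⟨h3, h4⟩
      refine ⟨(h1 x).2 h3, ?_⟩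
      by_cases h5 : θ < s
      · exact Or.inr (h4 h5 h2)
      · exact Or.inl (not_lt.1 h5)

theorem wdMin_ip_cont (hA : WdCorr μ M A) (θ : ℝ) : Continuous (fun q => wdMin A (wdIp q) θ) := by
  have := (hA.cpt θ).continuous_sInf (f := fun q x : EuclideanSpace ℝ (Fin T) => inner ℝ q x)
    (by fun_prop)
  exact this

theorem wd_freeze_cont [IsFiniteMeasure μ] [NullSingletonClass μ] (hM : 0 ≤ M)
    (hA : WdCorr μ M A) {a : ℝ → EuclideanSpace ℝ (Fin T)}
    (ha : Measurable a) (haA : ∀ᵐ θ ∂μ, a θ ∈ A θ) :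
    Continuous (fun p : ℝ × EuclideanSpace ℝ (Fin T) =>
      ∫ θ, wdMin (wdFreeze A a p.1) (wdIp p.2) θ ∂μ) := by
  rw [continuous_iff_continuousAt]
  rintro ⟨s, q⟩
  apply continuousAt_of_dominated (bound := fun _ => (‖q‖ + 1) * M)
  · exact Filter.Eventually.of_forall (fun p =>
      (wdMin_ip_int (hA.freeze ha haA p.1) p.2).aestronglyMeasurable)
  · have h1 : ∀ᶠ p : ℝ × EuclideanSpace ℝ (Fin T) in nhds (s, q), ‖p.2‖ < ‖q‖ + 1 := by
      have : Continuous (fun p : ℝ × EuclideanSpace ℝ (Fin T) => ‖p.2‖) := by fun_prop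
      exact this.continuousAt.eventually_lt continuousAt_const (by simp)
    filter_upwards [h1] with p hp
    refine Filter.Eventually.of_forall (fun θ => ?_)
    exact (wdMin_ip_bound (hA.freeze ha haA p.1) p.2 θ).trans
      (mul_le_mul_of_nonneg_right hp.le hM)
  · exact integrable_const _
  · have hs : ∀ᵐ θ ∂μ, θ ≠ s := by
      rw [ae_iff]; simp
    filter_upwards [hs] with θ hθ
    have h2 : ∀ᶠ p : ℝ × EuclideanSpace ℝ (Fin T) in nhds (s, q), (θ < p.1 ↔ θ < s) := by
      rcases lt_or_gt_of_ne hθ with h | h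
      · filter_upwards [continuous_fst.continuousAt.eventually (lt_mem_nhds h)] with p hp
        exact ⟨fun _ => h, fun _ => hp⟩
      · filter_upwards [continuous_fst.continuousAt.eventually (gt_mem_nhds h)] with p hp
        exact ⟨fun h3 => absurd h3 (not_lt.2 (le_of_lt hp)), fun h3 => absurd h3 (not_lt.2 h.le)⟩
    have h3 : ContinuousAt (fun p : ℝ × EuclideanSpace ℝ (Fin T) =>
        wdMin (wdFreeze A a s) (wdIp p.2) θ) (s, q) :=
      ((wdMin_ip_cont (hA.freeze ha haA s) θ).comp continuous_snd).continuousAt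
    refine h3.congr ?_
    filter_upwards [h2] with p hp
    unfold wdMin wdFreeze
    simp only [hp]

end

section
variable {T : ℕ} {M : ℝ}

theorem wd_int_inner {μ : Measure ℝ} {a : ℝ → EuclideanSpace ℝ (Fin T)} (ha : Integrable a μ)
    (q : EuclideanSpace ℝ (Fin T)) : ∫ θ, inner ℝ q (a θ) ∂μ = inner ℝ q (∫ θ, a θ ∂μ) :=
  integral_inner ha q

theorem wd_purify (hM : 0 ≤ M) (k : ℕ) : ∀ (S : Submodule ℝ (EuclideanSpace ℝ (Fin T))),
    Module.finrank ℝ S = k → ∀ (A : ℝ → Set (EuclideanSpace ℝ (Fin T))),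
    WdCorr (volume.restrict (Icc (0:ℝ) 1)) M A →
    (∀ θ, ∀ x ∈ A θ, ∀ y ∈ A θ, x - y ∈ S) → ∀ X : EuclideanSpace ℝ (Fin T),
    (∀ q, ∫ θ in Icc (0:ℝ) 1, wdMin A (wdIp q) θ ≤ inner ℝ q X) →
    ∃ a : ℝ → EuclideanSpace ℝ (Fin T), Measurable a ∧
      (∀ᵐ θ ∂(volume.restrict (Icc (0:ℝ) 1)), a θ ∈ A θ) ∧ ∫ θ in Icc (0:ℝ) 1, a θ = X := by
  induction k using Nat.strong_induction_on with
  | _ k ih =>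
  intro S hS A hA hAS X hX
  set μ := volume.restrict (Icc (0:ℝ) 1) with hμ
  obtain ⟨a, ha, haA⟩ := hA.select
  have haI : Integrable a μ := wd_sel_int hA ha haA
  -- behaviour on the orthogonal complement
  have horth : ∀ z ∈ Sᗮ, ∀ θ, ∀ x ∈ A θ, ∀ y ∈ A θ, inner ℝ z x = inner ℝ z y := by
    intro z hz θ x hx y hy
    have := (Submodule.mem_orthogonal' S z).1 hz _ (hAS θ x hx y hy)
    rw [inner_sub_right] at this
    linarith
  have hle : ∀ z ∈ Sᗮ, inner ℝ z (∫ θ, a θ ∂μ) ≤ inner ℝ z X := by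
    intro z hz
    rw [← wd_int_inner haI]
    refine le_trans (le_of_eq ?_) (hX z)
    apply integral_congr_ae
    filter_upwards [haA] with θ hθ
    exact (wdMin_eq (f := wdIp z) hθ (fun y hy => (horth z hz θ _ hθ y hy).le)).symm
  have hperp : ∀ z ∈ Sᗮ, inner ℝ z (∫ θ, a θ ∂μ) = inner ℝ z X := by
    intro z hz
    apply le_antisymm (hle z hz)
    have := hle (-z) (Submodule.neg_mem _ hz)
    rw [inner_neg_left, inner_neg_left] at this
    linarith
  by_cases hbot : S = ⊥
  · refine ⟨a, ha, haA, ?_⟩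
    apply ext_inner_left ℝ
    intro z
    apply hperp
    rw [hbot, Submodule.bot_orthogonal_eq_top]
    trivial
  -- unit sphere of S
  set Sg : Set (EuclideanSpace ℝ (Fin T)) := sphere 0 1 ∩ (S : Set (EuclideanSpace ℝ (Fin T)))
    with hSg
  have hSgc : IsCompact Sg := (isCompact_sphere 0 1).inter_right S.closed_of_finiteDimensional
  have hnorm : ∀ q ∈ S, q ≠ 0 → ‖q‖⁻¹ • q ∈ Sg := by
    intro q hq hq0
    refine ⟨?_, S.smul_mem _ hq⟩
    rw [mem_sphere_zero_iff_norm, norm_smul, norm_inv, norm_norm,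
      inv_mul_cancel₀ (norm_ne_zero_iff.2 hq0)]
  have hSgne : Sg.Nonempty := by
    obtain ⟨q, hq, hq0⟩ := (Submodule.ne_bot_iff S).1 hbot
    exact ⟨_, hnorm q hq hq0⟩
  let h : ℝ → EuclideanSpace ℝ (Fin T) → ℝ := fun s q =>
    ∫ θ, wdMin (wdFreeze A a s) (wdIp q) θ ∂μ
  let g : ℝ → EuclideanSpace ℝ (Fin T) → ℝ := fun s q => inner ℝ q X - h s q
  have hhc : Continuous (fun p : ℝ × EuclideanSpace ℝ (Fin T) => h p.1 p.2) :=
    wd_freeze_cont hM hA ha haA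
  have hgc : Continuous (fun p : ℝ × EuclideanSpace ℝ (Fin T) => g p.1 p.2) := by
    have : Continuous (fun p : ℝ × EuclideanSpace ℝ (Fin T) => inner ℝ p.2 X) := by fun_prop
    exact this.sub hhc
  have hgs : ∀ s, Continuous (g s) := fun s => hgc.comp (Continuous.prodMk_right s)
  let g0 : ℝ → ℝ := fun s => sInf (g s '' Sg)
  have hg0c : Continuous g0 := hSgc.continuous_sInf hgc
  have hg00 : 0 ≤ g0 0 := by
    apply le_csInf (hSgne.image _)
    rintro _ ⟨q, hq, rfl⟩
    have : h 0 q = ∫ θ, wdMin A (wdIp q) θ ∂μ := by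
      apply integral_congr_ae
      filter_upwards [ae_restrict_mem measurableSet_Icc] with θ hθ
      have e : wdFreeze A a 0 θ = A θ := wdFreeze_of_not (fun h => absurd h.1 (not_lt.2 hθ.1))
      simp only [wdMin, e]
    have h2 := hX q
    simp only [g]
    rw [this]
    linarith
  have hh1 : ∀ q, h 1 q = inner ℝ q (∫ θ, a θ ∂μ) := by
    intro q
    rw [← wd_int_inner haI]
    apply integral_congr_ae
    have hs : ∀ᵐ θ ∂μ, θ ≠ 1 := by
      rw [ae_iff]; simp
    filter_upwards [ae_restrict_mem measurableSet_Icc, hs, haA] with θ hθ h1 h2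
    have e : wdFreeze A a 1 θ = {a θ} := wdFreeze_of (lt_of_le_of_ne hθ.2 h1) h2
    simp only [wdMin, e, image_singleton, csInf_singleton, wdIp]
  have hg01 : g0 1 ≤ 0 := by
    have hb : ∀ q ∈ Sg, g0 1 ≤ g 1 q := fun q hq =>
      csInf_le (hSgc.image (hgs 1)).bddBelow (mem_image_of_mem _ hq)
    obtain ⟨q, hq⟩ := hSgne
    have hq' : -q ∈ Sg := by
      refine ⟨?_, S.neg_mem hq.2⟩
      rw [mem_sphere_zero_iff_norm, norm_neg]
      exact mem_sphere_zero_iff_norm.1 hq.1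
    have h1 := hb q hq
    have h2 := hb _ hq'
    simp only [g, hh1, inner_neg_left] at h1 h2
    linarith
  obtain ⟨s, -, hs⟩ := intermediate_value_Icc' (zero_le_one' ℝ) hg0c.continuousOn ⟨hg01, hg00⟩
  obtain ⟨q0, hq0, hq0m⟩ := (hSgc.image (hgs s)).sInf_mem (hSgne.image _)
  have hq0e : g s q0 = 0 := hq0m.trans hs
  have hgpos : ∀ q ∈ Sg, 0 ≤ g s q := by
    intro q hq
    rw [← hs]
    exact csInf_le (hSgc.image (hgs s)).bddBelow (mem_image_of_mem _ hq)
  have hF : WdCorr μ M (wdFreeze A a s) := hA.freeze ha haA s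
  have hS1 : ∀ q ∈ S, h s q ≤ inner ℝ q X := by
    intro q hq
    by_cases hq0 : q = 0
    · subst hq0
      have : h s 0 = 0 := by
        simp only [h]
        rw [← integral_zero ℝ ℝ (μ := μ)]
        apply integral_congr_ae
        refine Filter.Eventually.of_forall (fun θ => ?_)
        have := wdMin_ip_bound hF 0 θ
        simp only [norm_zero, zero_mul] at this
        exact abs_nonpos_iff.1 this
      rw [this, inner_zero_left]
    · have h1 := hgpos _ (hnorm q hq hq0)
      have hn : 0 < ‖q‖ := norm_pos_iff.2 hq0
      have h2 : h s (‖q‖⁻¹ • q) = ‖q‖⁻¹ * h s q := by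
        simp only [h]
        rw [← integral_const_mul]
        congr 1
        ext θ
        obtain ⟨x, hx, hxm⟩ := wdMin_mem hF (wdIp_cont q) θ
        rw [← hxm]
        have h3 : wdIp (‖q‖⁻¹ • q) θ x = ‖q‖⁻¹ * wdIp q θ x := by
          simp [wdIp, inner_smul_left]
        rw [← h3]
        apply wdMin_eq hx
        intro y hy
        have h4 : wdIp (‖q‖⁻¹ • q) θ y = ‖q‖⁻¹ * wdIp q θ y := by
          simp [wdIp, inner_smul_left]
        rw [h3, h4, hxm]
        exact mul_le_mul_of_nonneg_left (wdMin_le hF (wdIp_cont q) hy) (inv_nonneg.2 hn.le)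
      simp only [g] at h1
      rw [h2, inner_smul_left, conj_trivial, ← mul_sub] at h1
      have := nonneg_of_mul_nonneg_right h1 (inv_pos.2 hn)
      linarith
  have hall : ∀ q, h s q ≤ inner ℝ q X := by
    intro q
    obtain ⟨y, hy, z, hz, rfl⟩ := S.exists_add_mem_mem_orthogonal q
    have h1 : h s (y + z) = h s y + inner ℝ z (∫ θ, a θ ∂μ) := by
      rw [← wd_int_inner haI]
      simp only [h]
      rw [← integral_add (wdMin_ip_int hF y) (haI.const_inner z)]
      apply integral_congr_ae
      filter_upwards [haA] with θ hθ
      obtain ⟨x, hx, hxm⟩ := wdMin_mem hF (wdIp_cont y) θ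
      rw [← hxm, horth z hz θ _ hθ x hx.1]
      have h3 : ∀ x, wdIp (y + z) θ x = wdIp y θ x + inner ℝ z x := fun x => by
        simp [wdIp, inner_add_left]
      rw [← h3]
      apply wdMin_eq hx
      intro w hw
      rw [h3, h3, horth z hz θ x hx.1 w hw.1, hxm]
      have := wdMin_le hF (wdIp_cont y) hw
      linarith
    rw [h1, inner_add_left, hperp z hz]
    have := hS1 y hy
    linarith
  -- reduce the dimension
  have hB : WdCorr μ M (wdArg (wdFreeze A a s) (wdIp q0)) := hF.arg (wdIp_cont q0) (wdIp_meas q0)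
  let S' : Submodule ℝ (EuclideanSpace ℝ (Fin T)) := S ⊓ (ℝ ∙ q0)ᗮ
  have hlt : S' < S := by
    refine lt_of_le_of_ne inf_le_left (fun he => ?_)
    have h1 : q0 ∈ S' := by rw [he]; exact hq0.2
    have h2 := (Submodule.mem_orthogonal_singleton_iff_inner_right).1 h1.2
    rw [real_inner_self_eq_norm_sq, mem_sphere_zero_iff_norm.1 hq0.1] at h2
    norm_num at h2
  have hfin : Module.finrank ℝ S' < k := hS ▸ Submodule.finrank_lt_finrank_of_lt hlt
  obtain ⟨b, hb, hbA, hbX⟩ := ih _ hfin S' rfl _ hB (by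
    intro θ x hx y hy
    refine ⟨hAS θ x hx.1.1 y hy.1.1, ?_⟩
    apply (Submodule.mem_orthogonal_singleton_iff_inner_right).2
    rw [inner_sub_right]
    have h1 : inner ℝ q0 x = inner ℝ q0 y := hx.2.trans hy.2.symm
    linarith) X (by
    intro r
    apply wd_int_danskin hF (wdIp_cont q0) (wdIp_meas q0)
    intro q
    have h1 : ∫ θ, (wdMin (wdFreeze A a s) (fun θ x => wdIp q0 θ x + inner ℝ q x) θ
        - wdMin (wdFreeze A a s) (wdIp q0) θ) ∂μ = h s (q0 + q) - h s q0 := by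
      have e : (fun θ x => wdIp q0 θ x + inner ℝ q x) = wdIp (q0 + q) := by
        funext θ x
        simp [wdIp, inner_add_left]
      rw [e, integral_sub (wdMin_ip_int hF _) (wdMin_ip_int hF _)]
    rw [h1]
    have h2 := hall (q0 + q)
    rw [inner_add_left] at h2
    have h3 : inner ℝ q0 X - h s q0 = 0 := hq0e
    linarith)
  refine ⟨b, hb, ?_, hbX⟩
  filter_upwards [hbA] with θ hθ
  exact hθ.1.1

end

theorem wd_first_order (ψ : ℝ → ℝ) (D : ℝ) (h : HasDerivAt ψ D 0)
    (hmin : ∀ τ, 0 < τ → τ ≤ 1 → ψ 0 ≤ ψ τ) : 0 ≤ D := by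
  have h1 := h.tendsto_slope_zero_right
  refine ge_of_tendsto h1 ?_
  have h2 : ∀ᶠ τ : ℝ in nhdsWithin 0 (Ioi 0), τ < 1 :=
    (gt_mem_nhds (zero_lt_one' ℝ)).filter_mono nhdsWithin_le_nhds
  filter_upwards [h2, self_mem_nhdsWithin] with τ ht1 ht0
  have ht0' : 0 < τ := ht0
  rw [zero_add, smul_eq_mul]
  exact mul_nonneg (inv_nonneg.2 ht0'.le) (sub_nonneg.2 (hmin τ ht0' ht1.le))

/-- The potential argument. -/
theorem wd_potential {T : ℕ} {M : ℝ} (c : Fin T → ℝ → ℝ) (hc : ∀ t, Continuous (c t))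
    (V : EuclideanSpace ℝ (Fin T) → ℝ) (hV0 : V 0 = 0)
    (hsup : ∀ p, ∃ Y : EuclideanSpace ℝ (Fin T), ‖Y‖ ≤ M ∧ ∀ p', V p' ≤ V p + inner ℝ (p' - p) Y) :
    ∃ X p : EuclideanSpace ℝ (Fin T), (∀ t, p t = c t (X t)) ∧
      ∀ q, V (p + q) ≤ V p + inner ℝ q X := by
  let G : EuclideanSpace ℝ (Fin T) → ℝ := fun x => ∑ t, ∫ s in (0:ℝ)..(x t), c t s
  have hCd : ∀ t b, HasDerivAt (fun b => ∫ s in (0:ℝ)..b, c t s) (c t b) b := fun t b =>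
    ((hc t).integral_hasStrictDerivAt 0 b).hasDerivAt
  have hCc : ∀ t, Continuous (fun b => ∫ s in (0:ℝ)..b, c t s) := fun t =>
    continuous_iff_continuousAt.2 (fun b => (hCd t b).continuousAt)
  have hGc : Continuous G := by
    apply continuous_finset_sum
    intro t _
    exact (hCc t).comp (by fun_prop)
  obtain ⟨Y0, hY0, hY0s⟩ := hsup 0
  obtain ⟨x0, hx0, hx0m⟩ := (isCompact_closedBall (0 : EuclideanSpace ℝ (Fin T)) M).exists_isMinOn
    ⟨Y0, by simpa using hY0⟩ hGc.continuousOn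
  let Q : Set (EuclideanSpace ℝ (Fin T) × ℝ) :=
    {z | ‖z.1‖ ≤ M ∧ ∀ p, V p - inner ℝ p z.1 ≤ z.2}
  have hQc : IsClosed Q := by
    have : Q = {z | ‖z.1‖ ≤ M} ∩ ⋂ p, {z | V p - inner ℝ p z.1 ≤ z.2} := by
      ext z; simp [Q]
    rw [this]
    refine (isClosed_le (by fun_prop) (by fun_prop)).inter (isClosed_iInter fun p => ?_)
    exact isClosed_le (by fun_prop) (by fun_prop)
  have hQ0 : ∀ z ∈ Q, 0 ≤ z.2 := by
    intro z hz
    have := hz.2 0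
    rw [hV0, inner_zero_left] at this
    linarith
  have hQG : ∀ z ∈ Q, G x0 ≤ G z.1 := fun z hz => hx0m (by simpa using hz.1)
  have hst : (Y0, (0:ℝ)) ∈ Q := by
    refine ⟨hY0, fun p => ?_⟩
    have := hY0s p
    rw [hV0, sub_zero] at this
    show V p - inner ℝ p Y0 ≤ 0
    linarith
  let R : ℝ := G Y0 - G x0
  have hR : 0 ≤ R := sub_nonneg.2 (hQG _ hst)
  have hcpt : IsCompact ((closedBall (0 : EuclideanSpace ℝ (Fin T)) M ×ˢ Icc (0:ℝ) R) ∩ Q) :=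
    ((isCompact_closedBall _ _).prod isCompact_Icc).inter_right hQc
  have hOc : Continuous (fun z : EuclideanSpace ℝ (Fin T) × ℝ => G z.1 + z.2) := by fun_prop
  obtain ⟨z, ⟨hzb, hzQ⟩, hzm⟩ := hcpt.exists_isMinOn
    ⟨(Y0, 0), ⟨by simpa using hY0, le_rfl, hR⟩, hst⟩ hOc.continuousOn
  have hzmin : ∀ w ∈ Q, G z.1 + z.2 ≤ G w.1 + w.2 := by
    intro w hw
    by_cases hwR : w.2 ≤ R
    · exact hzm ⟨⟨by simpa using hw.1, hQ0 w hw, hwR⟩, hw⟩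
    · have h1 : G z.1 + z.2 ≤ G Y0 + 0 := hzm ⟨⟨by simpa using hY0, le_rfl, hR⟩, hst⟩
      have h2 := hQG w hw
      simp only [R] at hwR
      linarith
  obtain ⟨X, w⟩ := z
  let p : EuclideanSpace ℝ (Fin T) := WithLp.toLp 2 (fun t => c t (X t))
  refine ⟨X, p, fun t => rfl, ?_⟩
  obtain ⟨Y, hY, hYs⟩ := hsup p
  have hYQ : (Y, V p - inner ℝ p Y) ∈ Q := by
    refine ⟨hY, fun p' => ?_⟩
    have := hYs p'
    rw [inner_sub_left] at this
    show V p' - inner ℝ p' Y ≤ V p - inner ℝ p Y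
    linarith
  set v := V p - inner ℝ p Y with hv
  have hD : 0 ≤ (∑ t, c t (X t) * (Y t - X t)) + (v - w) := by
    apply wd_first_order (fun τ => G (X + τ • (Y - X)) + (w + τ * (v - w)))
    · apply HasDerivAt.add
      · apply HasDerivAt.fun_sum
        intro t _
        have h1 : HasDerivAt (fun τ : ℝ => X t + τ * (Y t - X t)) (Y t - X t) 0 := by
          simpa using ((hasDerivAt_id (0:ℝ)).mul_const (Y t - X t)).const_add (X t)
        have h2 := hCd t (X t)
        have h3 : HasDerivAt (fun b => ∫ s in (0:ℝ)..b, c t s) (c t (X t))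
          (X t + 0 * (Y t - X t)) := by simpa using h2
        exact HasDerivAt.comp (0:ℝ) h3 h1
      · simpa using ((hasDerivAt_id (0:ℝ)).mul_const (v - w)).const_add w
    · intro τ h0 h1
      have hmem : (X + τ • (Y - X), w + τ * (v - w)) ∈ Q := by
        refine ⟨?_, fun p' => ?_⟩
        · have : X + τ • (Y - X) = (1 - τ) • X + τ • Y := by module
          show ‖X + τ • (Y - X)‖ ≤ M
          rw [this]
          have hX : ‖X‖ ≤ M := hzQ.1
          calc _ ≤ ‖(1 - τ) • X‖ + ‖τ • Y‖ := norm_add_le _ _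
            _ = (1 - τ) * ‖X‖ + τ * ‖Y‖ := by
              rw [norm_smul, norm_smul, Real.norm_of_nonneg (by linarith),
                Real.norm_of_nonneg h0.le]
            _ ≤ M := by nlinarith
        · show V p' - inner ℝ p' (X + τ • (Y - X)) ≤ w + τ * (v - w)
          rw [inner_add_right, inner_smul_right, inner_sub_right]
          have e1 : V p' - inner ℝ p' X ≤ w := hzQ.2 p'
          have e2 : V p' - inner ℝ p' Y ≤ v := hYQ.2 p'
          nlinarith
      have := hzmin _ hmem
      simpa using this
  have hip : (∑ t, c t (X t) * (Y t - X t)) = inner ℝ p Y - inner ℝ p X := by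
    rw [← inner_sub_right, PiLp.inner_apply]
    apply Finset.sum_congr rfl
    intro t _
    simp [p, mul_comm]
  rw [hip] at hD
  intro q
  have h1 : V (p + q) - inner ℝ (p + q) X ≤ w := hzQ.2 (p + q)
  rw [inner_add_left] at h1
  linarith

theorem statement3 {T : ℕ} (hT : 1 ≤ T) (M Γ : ℝ) (hM : 0 < M)
    (X : ℝ → Set (EuclideanSpace ℝ (Fin T)))
    (hXne : ∀ θ, (X θ).Nonempty)
    (hXconv : ∀ θ, Convex ℝ (X θ))
    (hXcpt : ∀ θ, IsCompact (X θ))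
    (hXball : ∀ θ, X θ ⊆ closedBall 0 M)
    (hXpos : ∀ θ, ∀ x ∈ X θ, ∀ t, 0 ≤ x t)
    (hXgraph : MeasurableSet {p : ℝ × EuclideanSpace ℝ (Fin T) | p.2 ∈ X p.1})
    (c : Fin T → ℝ → ℝ)
    (hccont : ∀ t, Continuous (c t))
    (u : ℝ → EuclideanSpace ℝ (Fin T) → ℝ)
    (hucont : ∀ θ, Continuous (u θ))
    (humeas : Measurable (fun p : ℝ × EuclideanSpace ℝ (Fin T) => u p.1 p.2)) :
    ∃ xstar : ℝ → EuclideanSpace ℝ (Fin T),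
      Measurable xstar ∧
      (∀ᵐ θ ∂(volume.restrict (Icc (0:ℝ) 1)), xstar θ ∈ X θ) ∧
      (∀ᵐ θ ∂(volume.restrict (Icc (0:ℝ) 1)), ∀ y ∈ X θ,
        (∑ t, xstar θ t * c t ((∫ ζ in Icc (0:ℝ) 1, xstar ζ) t)) - u θ (xstar θ)
          ≤ (∑ t, y t * c t ((∫ ζ in Icc (0:ℝ) 1, xstar ζ) t)) - u θ y) := by
  set μ := volume.restrict (Icc (0:ℝ) 1) with hμ
  have hμ1 : μ.real univ = 1 := by simp [hμ]
  have hA : WdCorr μ M X := ⟨hXcpt, hXne, fun θ x hx => by simpa using hXball θ hx,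
    _, hXgraph, Filter.Eventually.of_forall (fun θ x => Iff.rfl)⟩
  let f : ℝ → EuclideanSpace ℝ (Fin T) → ℝ := fun θ x => - u θ x
  have hf : ∀ θ, Continuous (f θ) := fun θ => (hucont θ).neg
  have hfm : Measurable (fun p : ℝ × EuclideanSpace ℝ (Fin T) => f p.1 p.2) := humeas.neg
  let F : EuclideanSpace ℝ (Fin T) → ℝ → EuclideanSpace ℝ (Fin T) → ℝ :=
    fun p θ x => f θ x + inner ℝ p x
  have hF : ∀ p θ, Continuous (F p θ) := fun p θ => (hf θ).add (wdIp_cont p θ)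
  have hFm : ∀ p, Measurable (fun z : ℝ × EuclideanSpace ℝ (Fin T) => F p z.1 z.2) :=
    fun p => wd_meas_add hfm p
  let V : EuclideanSpace ℝ (Fin T) → ℝ := fun p => ∫ θ, (wdMin X (F p) θ - wdMin X f θ) ∂μ
  have hVI : ∀ p, Integrable (fun θ => wdMin X (F p) θ - wdMin X f θ) μ := fun p =>
    wdMin_diff_int hA hf hfm p
  have hV0 : V 0 = 0 := by
    have : F 0 = f := by funext θ x; simp [F]
    simp [V, this]
  obtain ⟨Xs, p, hp, hVp⟩ := wd_potential (M := M) c hccont V hV0 (by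
    intro p
    have hC : WdCorr μ M (wdArg X (F p)) := hA.arg (hF p) (hFm p)
    obtain ⟨y, hy, hyA⟩ := hC.select
    have hyI := wd_sel_int hC hy hyA
    refine ⟨∫ θ, y θ ∂μ, ?_, fun p' => ?_⟩
    · have := norm_integral_le_of_norm_le_const (μ := μ) (f := y) (C := M) (by
        filter_upwards [hyA] with θ h using hC.ball θ _ h)
      rwa [hμ1, mul_one] at this
    · rw [← wd_int_inner hyI]
      simp only [V]
      rw [← integral_add (hVI p) (hyI.const_inner _)]
      apply integral_mono_ae (hVI p') ((hVI p).add (hyI.const_inner _))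
      filter_upwards [hyA] with θ hθ
      have h1 := wdMin_le hA (hF p') hθ.1
      have h2 := hθ.2
      simp only [F] at h1 h2 ⊢
      simp only [Pi.add_apply, inner_sub_left]
      linarith)
  have hC : WdCorr μ M (wdArg X (F p)) := hA.arg (hF p) (hFm p)
  have hkey : ∀ q, ∫ θ, wdMin (wdArg X (F p)) (wdIp q) θ ∂μ ≤ inner ℝ q Xs := by
    apply wd_int_danskin hA (hF p) (hFm p)
    intro q
    have e : (fun θ x => F p θ x + inner ℝ q x) = F (p + q) := by
      funext θ x
      simp [F, inner_add_left, add_assoc]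
    have e2 : ∫ θ, (wdMin X (F (p + q)) θ - wdMin X (F p) θ) ∂μ = V (p + q) - V p := by
      simp only [V]
      rw [← integral_sub (hVI _) (hVI _)]
      congr 1
      funext θ
      ring
    rw [e, e2]
    have := hVp q
    linarith
  obtain ⟨a, ha, haA, haX⟩ := wd_purify hM.le _ ⊤ rfl _ hC (fun _ _ _ _ _ => trivial) Xs hkey
  refine ⟨a, ha, ?_, ?_⟩
  · filter_upwards [haA] with θ hθ using hθ.1
  · rw [haX]
    filter_upwards [haA] with θ hθ y hy
    have hs : ∀ x : EuclideanSpace ℝ (Fin T), ∑ t, x t * c t (Xs t) = inner ℝ p x := by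
      intro x
      rw [PiLp.inner_apply]
      apply Finset.sum_congr rfl
      intro t _
      simp [hp]
    rw [hs, hs]
    have h1 := wdMin_le hA (hF p) hy
    have h2 := hθ.2
    simp only [F, f] at h1 h2
    linarith
end

section
/- Integrated variational formulation of a Wardrop equilibrium: assume each c_t is differentiable, convex and increasing. A profile x* (measurable, x*_θ ∈ X_θ a.e., aggregate X* = ∫_Θ x*_θ dθ) is a Wardrop equilibrium if and only if for every profile x (measurable with x_θ ∈ X_θ a.e.): ∫_Θ ⟨c(X*) − ∇u_θ(x*_θ), x_θ − x*_θ⟩ dθ ≥ 0. -/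
open scoped RealInnerProductSpace BigOperators
open Metric Set MeasureTheory

/-- Capacitability: an analytic subset of the line with positive (outer) measure contains
a compact set of positive measure, presented along the parametrization. -/
lemma exists_compact_pos_measure (μ : Measure ℝ) [IsFiniteMeasure μ]
    (g : (ℕ → ℕ) → ℝ) (hg : Continuous g) (hpos : 0 < μ (range g)) :
    ∃ C : Set (ℕ → ℕ), IsCompact C ∧ 0 < μ (g '' C) := by
  obtain ⟨ε, hε0, hε⟩ := exists_between hpos
  have step : ∀ (A : Set (ℕ → ℕ)) (k : ℕ), ∃ m : ℕ,
      ε < μ (g '' A) → ε < μ (g '' (A ∩ {σ | σ k ≤ m})) := by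
    intro A k
    by_cases h : ε < μ (g '' A)
    · have hU : g '' A = ⋃ m : ℕ, g '' (A ∩ {σ | σ k ≤ m}) := by
        rw [← image_iUnion, ← inter_iUnion]
        congr 1
        ext σ
        simp only [mem_inter_iff, mem_iUnion, mem_ofPred_eq]
        exact ⟨fun hσ => ⟨hσ, σ k, le_rfl⟩, fun hσ => hσ.1⟩
      have hmono : Monotone (fun m : ℕ => g '' (A ∩ {σ | σ k ≤ m})) := by
        intro a b hab
        refine image_mono (inter_subset_inter_right _ ?_)
        intro σ hσ
        exact le_trans hσ hab
      rw [hU, hmono.measure_iUnion, lt_iSup_iff] at h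
      obtain ⟨m, hm⟩ := h
      exact ⟨m, fun _ => hm⟩
    · exact ⟨0, fun h' => absurd h' h⟩
  choose m hm using step
  let A : ℕ → Set (ℕ → ℕ) := fun k =>
    Nat.rec univ (fun k B => B ∩ {σ | σ k ≤ m B k}) k
  have hA0 : A 0 = univ := rfl
  have hAs : ∀ k, A (k + 1) = A k ∩ {σ | σ k ≤ m (A k) k} := fun k => rfl
  have hAε : ∀ k, ε < μ (g '' A k) := by
    intro k
    induction k with
    | zero => rw [hA0, image_univ]; exact hε
    | succ k ih => rw [hAs]; exact hm _ _ ih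
  let n : ℕ → ℕ := fun k => m (A k) k
  have hAmem : ∀ k, ∀ σ ∈ A k, ∀ i < k, σ i ≤ n i := by
    intro k
    induction k with
    | zero => intro σ _ i hi; omega
    | succ k ih =>
      intro σ hσ i hi
      rw [hAs] at hσ
      rcases Nat.lt_succ_iff_lt_or_eq.1 hi with h | h
      · exact ih σ hσ.1 i h
      · subst h; exact hσ.2
  have hC : IsCompact (Set.pi univ (fun k => Iic (n k))) :=
    isCompact_univ_pi (fun k => (Set.finite_Iic (n k)).isCompact)
  refine ⟨Set.pi univ (fun k => Iic (n k)), hC, lt_of_lt_of_le hε0 ?_⟩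
  by_contra hlt
  push Not at hlt
  obtain ⟨U, hCU, hUo, hUε⟩ := Set.exists_isOpen_lt_of_lt _ _ hlt
  have hex : ∀ k, ∃ σ ∈ A k, g σ ∉ U := by
    intro k
    by_contra hcon
    push Not at hcon
    have : μ (g '' A k) ≤ μ U := measure_mono (by rintro _ ⟨σ, hσ, rfl⟩; exact hcon σ hσ)
    exact absurd (lt_of_lt_of_le (hAε k) this) (not_lt.2 hUε.le)
  choose σ hσA hσU using hex
  obtain ⟨τ, hτC, φ, hφ, hlim⟩ := hC.tendsto_subseq
    (x := fun k i => min (σ k i) (n i)) (fun k i _ => mem_Iic.2 (min_le_right (σ k i) (n i)))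
  have hlim2 : Filter.Tendsto (fun j => σ (φ j)) Filter.atTop (nhds τ) := by
    rw [tendsto_pi_nhds] at hlim ⊢
    intro i
    refine (hlim i).congr' ?_
    filter_upwards [Filter.eventually_gt_atTop i] with j hj
    exact min_eq_left (hAmem _ _ (hσA (φ j)) i (lt_of_lt_of_le hj (hφ.id_le j)))
  have hcl : IsClosed (g ⁻¹' Uᶜ) := hUo.isClosed_compl.preimage hg
  have hmem : τ ∈ g ⁻¹' Uᶜ :=
    hcl.mem_of_tendsto hlim2 (Filter.Eventually.of_forall fun j => hσU (φ j))
  exact hmem (hCU ⟨τ, hτC, rfl⟩)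

/-- A measurable section over the continuous image of a compact set. -/
lemma exists_measurable_section (C : Set (ℕ → ℕ)) (hC : IsCompact C)
    (g : (ℕ → ℕ) → ℝ) (hg : Continuous g) :
    ∃ s : ℝ → (ℕ → ℕ), Measurable s ∧ ∀ θ ∈ g '' C, g (s θ) = θ := by
  rcases C.eq_empty_or_nonempty with rfl | hne
  · exact ⟨fun _ => 0, measurable_const, by simp⟩
  letI : MetricSpace C := TopologicalSpace.metrizableSpaceMetric C
  haveI : Nonempty C := hne.to_subtype
  haveI : CompactSpace C := isCompact_iff_compactSpace.1 hC
  obtain ⟨h, hhc, hhs⟩ := exists_nat_bool_continuous_surjective_of_compact C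
  let q : cantorSet → (ℕ → ℕ) := fun d => (h (cantorSetHomeomorphNatToBool d) : ℕ → ℕ)
  have hq : Continuous q :=
    continuous_subtype_val.comp (hhc.comp cantorSetHomeomorphNatToBool.continuous)
  have hqr : ∀ σ ∈ C, ∃ d, q d = σ := by
    intro σ hσ
    obtain ⟨b, hb⟩ := hhs ⟨σ, hσ⟩
    refine ⟨cantorSetHomeomorphNatToBool.symm b, ?_⟩
    simp [q, hb]
  haveI : CompactSpace cantorSet := isCompact_iff_compactSpace.1 isCompact_cantorSet
  let d0 : cantorSet := ⟨0, zero_mem_cantorSet⟩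
  have hgq : Continuous (fun d => g (q d)) := hg.comp hq
  have hPr : g '' C = range (fun d => g (q d)) := by
    ext θ
    constructor
    · rintro ⟨σ, hσ, rfl⟩
      obtain ⟨d, rfl⟩ := hqr σ hσ
      exact ⟨d, rfl⟩
    · rintro ⟨d, rfl⟩
      exact ⟨q d, (h _).2, rfl⟩
  have hPm : MeasurableSet (g '' C) := (hC.image hg).measurableSet
  have hex : ∀ θ, ∃ d : cantorSet, (θ ∈ g '' C → g (q d) = θ ∧
      ∀ e : cantorSet, g (q e) = θ → (d : ℝ) ≤ e) ∧ (θ ∉ g '' C → d = d0) := by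
    intro θ
    by_cases hθ : θ ∈ g '' C
    · have hK : IsCompact {d : cantorSet | g (q d) = θ} :=
        (isClosed_singleton.preimage hgq).isCompact
      have hKn : {d : cantorSet | g (q d) = θ}.Nonempty := by
        rw [hPr] at hθ; exact hθ
      obtain ⟨d, hd, hdmin⟩ := hK.exists_isMinOn hKn
        (f := fun d : cantorSet => (d : ℝ)) continuous_subtype_val.continuousOn
      exact ⟨d, fun _ => ⟨hd, fun e he => hdmin he⟩, fun h => absurd hθ h⟩
    · exact ⟨d0, fun h => absurd h hθ, fun _ => rfl⟩
  choose r hr1 hr2 using hex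
  have hrm : Measurable (fun θ => (r θ : ℝ)) := by
    refine measurable_of_Iic fun a => ?_
    have hK : IsCompact ((fun d => g (q d)) '' {d : cantorSet | (d : ℝ) ≤ a}) :=
      ((isClosed_Iic.preimage continuous_subtype_val).isCompact).image hgq
    have : (fun θ => (r θ : ℝ)) ⁻¹' Iic a =
        ((fun d => g (q d)) '' {d : cantorSet | (d : ℝ) ≤ a}) ∪
          ((g '' C)ᶜ ∩ {_θ | (d0 : ℝ) ≤ a}) := by
      ext θ
      simp only [mem_preimage, mem_Iic, mem_union, mem_inter_iff, mem_compl_iff, mem_ofPred_eq]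
      by_cases hθ : θ ∈ g '' C
      · constructor
        · intro h
          exact Or.inl ⟨r θ, h, (hr1 θ hθ).1⟩
        · rintro (⟨d, hd, hdθ⟩ | h)
          · exact le_trans ((hr1 θ hθ).2 d hdθ) hd
          · exact absurd hθ h.1
      · rw [hr2 θ hθ]
        constructor
        · intro h; exact Or.inr ⟨hθ, h⟩
        · rintro (⟨d, hd, hdθ⟩ | h)
          · exact absurd (hPr ▸ ⟨d, hdθ⟩) hθ
          · exact h.2
    rw [this]
    exact hK.measurableSet.union (hPm.compl.inter (MeasurableSet.const _))
  have hrm' : Measurable r := by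
    have := hrm.subtype_mk (h := fun θ => (r θ).2)
    exact this
  exact ⟨fun θ => q (r θ), hq.measurable.comp hrm', fun θ hθ => (hr1 θ hθ).1⟩

/-- Measurable selection from a Borel set whose projection is not null. -/
lemma exists_selection_pos {E : Type*} [TopologicalSpace E] [PolishSpace E] [MeasurableSpace E]
    [BorelSpace E] (μ : Measure ℝ) [IsFiniteMeasure μ] (A : Set (ℝ × E)) (hA : MeasurableSet A)
    (hpos : 0 < μ {θ | ∃ y, (θ, y) ∈ A}) :
    ∃ (P : Set ℝ) (z : ℝ → E), MeasurableSet P ∧ Measurable z ∧ 0 < μ P ∧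
      ∀ θ ∈ P, (θ, z θ) ∈ A := by
  have hAn := hA.analyticSet
  rw [AnalyticSet] at hAn
  rcases hAn with rfl | ⟨f, hf, rfl⟩
  · simp at hpos
  have hg : Continuous (fun σ => (f σ).1) := continuous_fst.comp hf
  have hr : {θ | ∃ y, (θ, y) ∈ range f} = range (fun σ => (f σ).1) := by
    ext θ
    constructor
    · rintro ⟨y, σ, hσ⟩
      exact ⟨σ, by simp [hσ]⟩
    · rintro ⟨σ, rfl⟩
      exact ⟨(f σ).2, σ, rfl⟩
  rw [hr] at hpos
  obtain ⟨C, hC, hCpos⟩ := exists_compact_pos_measure μ _ hg hpos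
  obtain ⟨s, hs, hsec⟩ := exists_measurable_section C hC _ hg
  refine ⟨_, fun θ => (f (s θ)).2, (hC.image hg).measurableSet,
    (continuous_snd.comp hf).measurable.comp hs, hCpos, fun θ hθ => ⟨s θ, ?_⟩⟩
  exact Prod.ext (hsec θ hθ) rfl

/-- First-order condition for a differentiable concave utility with linear cost. -/
lemma first_order_iff {T : ℕ} (S : Set (EuclideanSpace ℝ (Fin T))) (hS : Convex ℝ S)
    (v : EuclideanSpace ℝ (Fin T) → ℝ) (hv : ConcaveOn ℝ Set.univ v)
    (a gv p : EuclideanSpace ℝ (Fin T)) (hp : p ∈ S) (hgv : HasGradientAt v gv p) :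
    (∀ y ∈ S, (∑ t, p t * a t) - v p ≤ (∑ t, y t * a t) - v y) ↔
      ∀ y ∈ S, 0 ≤ ⟪a - gv, y - p⟫ := by
  have hsum : ∀ y : EuclideanSpace ℝ (Fin T), (∑ t, y t * a t) = ⟪a, y⟫ := by
    intro y
    simp [PiLp.inner_apply]
  simp only [hsum]
  have hderiv : HasFDerivAt (fun y => ⟪a, y⟫ - v y)
      (innerSL ℝ a - innerSL ℝ gv) p := by
    have h1 : HasFDerivAt (fun y => (innerSL ℝ a) y) (innerSL ℝ a) p :=
      (innerSL ℝ a).hasFDerivAt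
    have h2 := hgv.hasFDerivAt
    exact h1.sub h2
  constructor
  · intro h y hy
    have hmin : IsLocalMinOn (fun y => ⟪a, y⟫ - v y) S p :=
      IsMinOn.localize (fun y hy => h y hy)
    have := hmin.hasFDerivWithinAt_nonneg hderiv.hasFDerivWithinAt
      (sub_mem_posTangentConeAt_of_segment_subset (hS.segment_subset hp hy))
    simpa [inner_sub_left] using this
  · intro h y hy
    have h0 := h y hy
    have hconv : ConvexOn ℝ univ (fun y => ⟪a, y⟫ - v y) :=
      ((innerSL ℝ a).toLinearMap.convexOn convex_univ).sub hv
    let φ : ℝ → ℝ := fun s => ⟪a, AffineMap.lineMap p y s⟫ - v (AffineMap.lineMap p y s)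
    have hφ : ConvexOn ℝ univ φ := hconv.comp_affineMap (AffineMap.lineMap p y)
    have hφd : HasDerivAt φ ((innerSL ℝ a - innerSL ℝ gv) (y - p)) 0 := by
      have hl : HasDerivAt (fun s : ℝ => AffineMap.lineMap p y s) (y - p) (0:ℝ) :=
        AffineMap.hasDerivAt_lineMap
      have hd : HasFDerivAt (fun y => ⟪a, y⟫ - v y)
        (innerSL ℝ a - innerSL ℝ gv) (AffineMap.lineMap p y (0:ℝ)) := by simpa using hderiv
      exact hd.comp_hasDerivAt (0:ℝ) hl
    have hsl := hφ.le_slope_of_hasDerivAt (mem_univ 0) (mem_univ 1) one_pos hφd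
    have h3 : (innerSL ℝ a - innerSL ℝ gv) (y - p) = ⟪a - gv, y - p⟫ := by
      simp [inner_sub_left]
    rw [h3] at hsl
    simp [slope, φ] at hsl
    linarith

/-- Integrated variational formulation of a Wardrop equilibrium.
Nonatomic routing game on `Θ = [0,1]` with `T` parallel arcs: strategy sets
`X θ` nonempty convex compact, in the nonnegative orthant and in `B(0,M)`,
measurable graph; costs `c t` differentiable (derivative `c' t`), convex,
increasing; utilities `u θ` differentiable (gradient `gu θ`, jointly
measurable), concave, `‖∇u_θ‖ ≤ Γ`. A measurable profile `xstar` with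
`xstar θ ∈ X θ` a.e. and aggregate `Xagg = ∫_Θ xstar` is a Wardrop
equilibrium iff for every measurable profile `x` with `x θ ∈ X θ` a.e.:
`∫_Θ ⟪c(Xagg) - ∇u_θ(xstar θ), x θ - xstar θ⟫ dθ ≥ 0`. -/
theorem statement4 {T : ℕ} (hT : 1 ≤ T) (M Γ : ℝ) (hM : 0 < M)
    (X : ℝ → Set (EuclideanSpace ℝ (Fin T)))
    (hXne : ∀ θ, (X θ).Nonempty)
    (hXconv : ∀ θ, Convex ℝ (X θ))
    (hXcpt : ∀ θ, IsCompact (X θ))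
    (hXball : ∀ θ, X θ ⊆ closedBall 0 M)
    (hXpos : ∀ θ, ∀ x ∈ X θ, ∀ t, 0 ≤ x t)
    (hXgraph : MeasurableSet {p : ℝ × EuclideanSpace ℝ (Fin T) | p.2 ∈ X p.1})
    (c c' : Fin T → ℝ → ℝ)
    (hc : ∀ t s, HasDerivAt (c t) (c' t s) s)
    (hcconv : ∀ t, ConvexOn ℝ Set.univ (c t))
    (hcmono : ∀ t, StrictMono (c t))
    (u : ℝ → EuclideanSpace ℝ (Fin T) → ℝ)
    (gu : ℝ → EuclideanSpace ℝ (Fin T) → EuclideanSpace ℝ (Fin T))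
    (hu : ∀ θ x, HasGradientAt (u θ) (gu θ x) x)
    (huconc : ∀ θ, ConcaveOn ℝ Set.univ (u θ))
    (hgubd : ∀ θ x, ‖gu θ x‖ ≤ Γ)
    (humeas : Measurable (fun p : ℝ × EuclideanSpace ℝ (Fin T) => u p.1 p.2))
    (hgumeas : Measurable (fun p : ℝ × EuclideanSpace ℝ (Fin T) => gu p.1 p.2))
    (xstar : ℝ → EuclideanSpace ℝ (Fin T))
    (hmeas : Measurable xstar)
    (hfeas : ∀ᵐ θ ∂(volume.restrict (Icc (0:ℝ) 1)), xstar θ ∈ X θ)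
    (Xagg : EuclideanSpace ℝ (Fin T))
    (hXagg : Xagg = ∫ θ in Icc (0:ℝ) 1, xstar θ) :
    ((∀ᵐ θ ∂(volume.restrict (Icc (0:ℝ) 1)), ∀ y ∈ X θ,
        (∑ t, xstar θ t * c t (Xagg t)) - u θ (xstar θ)
          ≤ (∑ t, y t * c t (Xagg t)) - u θ y)
      ↔
      (∀ x : ℝ → EuclideanSpace ℝ (Fin T), Measurable x →
        (∀ᵐ θ ∂(volume.restrict (Icc (0:ℝ) 1)), x θ ∈ X θ) →
        0 ≤ ∫ θ in Icc (0:ℝ) 1,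
          ⟪((WithLp.equiv 2 (Fin T → ℝ)).symm fun t => c t (Xagg t)) - gu θ (xstar θ),
            x θ - xstar θ⟫)) := by
  set μ : Measure ℝ := volume.restrict (Icc (0:ℝ) 1) with hμ
  haveI : IsFiniteMeasure μ := by rw [hμ]; infer_instance
  set a : EuclideanSpace ℝ (Fin T) :=
    (WithLp.equiv 2 (Fin T → ℝ)).symm fun t => c t (Xagg t) with ha
  have key : (∀ᵐ θ ∂μ, ∀ y ∈ X θ, (∑ t, xstar θ t * c t (Xagg t)) - u θ (xstar θ)
      ≤ (∑ t, y t * c t (Xagg t)) - u θ y) ↔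
      ∀ᵐ θ ∂μ, ∀ y ∈ X θ, 0 ≤ ⟪a - gu θ (xstar θ), y - xstar θ⟫ := by
    refine Filter.eventually_congr ?_
    filter_upwards [hfeas] with θ hθ
    exact first_order_iff (X θ) (hXconv θ) (u θ) (huconc θ) a _ _ hθ (hu θ _)
  rw [key]
  constructor
  · intro h x _ hxf
    refine integral_nonneg_of_ae ?_
    filter_upwards [h, hxf] with θ h1 h2
    exact h1 _ h2
  · intro h
    by_contra hcon
    have hGm : Measurable (fun θ => a - gu θ (xstar θ)) :=
      measurable_const.sub (hgumeas.comp (measurable_id.prodMk hmeas))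
    let A : Set (ℝ × EuclideanSpace ℝ (Fin T)) :=
      {p | p.2 ∈ X p.1} ∩ {p | ⟪a - gu p.1 (xstar p.1), p.2 - xstar p.1⟫ < 0}
    have hA : MeasurableSet A := by
      refine hXgraph.inter (measurableSet_lt ?_ measurable_const)
      exact (hGm.comp measurable_fst).inner (measurable_snd.sub (hmeas.comp measurable_fst))
    have hpos : 0 < μ {θ | ∃ y, (θ, y) ∈ A} := by
      rw [pos_iff_ne_zero]
      intro h0
      apply hcon
      rw [ae_iff]
      refine measure_mono_null ?_ h0
      intro θ hθ
      simp only [mem_ofPred_eq] at hθ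
      push Not at hθ
      obtain ⟨y, hy, hlt⟩ := hθ
      exact ⟨y, hy, hlt⟩
    obtain ⟨P, z, hP, hz, hPpos, hPz⟩ := exists_selection_pos μ A hA hpos
    classical
    let x : ℝ → EuclideanSpace ℝ (Fin T) := P.piecewise z xstar
    have hx : Measurable x := hz.piecewise hP hmeas
    have hxP : ∀ θ ∈ P, x θ = z θ := fun θ hθ => piecewise_eq_of_mem _ _ _ hθ
    have hxN : ∀ θ, θ ∉ P → x θ = xstar θ := fun θ hθ => piecewise_eq_of_notMem _ _ _ hθ
    have hxf : ∀ᵐ θ ∂μ, x θ ∈ X θ := by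
      filter_upwards [hfeas] with θ hθ
      by_cases hp : θ ∈ P
      · rw [hxP θ hp]; exact (hPz θ hp).1
      · rw [hxN θ hp]; exact hθ
    have hint := h x hx hxf
    let F : ℝ → ℝ := fun θ => ⟪a - gu θ (xstar θ), x θ - xstar θ⟫
    have hFm : Measurable F := hGm.inner (hx.sub hmeas)
    have hFP : ∀ θ ∈ P, F θ < 0 := by
      intro θ hp
      simp only [F]
      rw [hxP θ hp]; exact (hPz θ hp).2
    have hFle : ∀ θ, 0 ≤ -F θ := by
      intro θ
      by_cases hp : θ ∈ P
      · linarith [hFP θ hp]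
      · simp [F, hxN θ hp]
    have hFi : Integrable F μ := by
      refine Integrable.of_bound hFm.aestronglyMeasurable ((‖a‖ + Γ) * (M + M)) ?_
      filter_upwards [hfeas, hxf] with θ h1 h2
      have b1 : ‖xstar θ‖ ≤ M := by simpa using hXball θ h1
      have b2 : ‖x θ‖ ≤ M := by simpa using hXball θ h2
      have b3 := hgubd θ (xstar θ)
      have b4 : ‖a - gu θ (xstar θ)‖ ≤ ‖a‖ + Γ := (norm_sub_le _ _).trans (by linarith)
      have b5 : ‖x θ - xstar θ‖ ≤ M + M := (norm_sub_le _ _).trans (by linarith)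
      exact (norm_inner_le_norm _ _).trans
        (mul_le_mul b4 b5 (norm_nonneg _) ((norm_nonneg _).trans b4))
    have hnonneg : 0 ≤ ∫ θ, -F θ ∂μ := integral_nonneg hFle
    have hzero : ∫ θ, -F θ ∂μ = 0 := by
      refine le_antisymm ?_ hnonneg
      rw [integral_neg]
      have : 0 ≤ ∫ θ, F θ ∂μ := hint
      linarith
    have hae := (integral_eq_zero_iff_of_nonneg hFle hFi.neg).1 hzero
    have hP0 : μ P = 0 := by
      refine measure_mono_null ?_ (ae_iff.1 hae)
      intro θ hp
      have := hFP θ hp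
      simp only [mem_ofPred_eq, Pi.zero_apply]
      intro h0
      linarith
    exact absurd hP0 hPpos.ne'
end
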